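/- Let m ≥ 1, p = 3, p1 = 7, p2 = 5, N = 7^m·5, and q = 3^{12·7^{m−1}} (so that the exponent equals φ(N)/2 = ord_N(3)). Then for every k with 0 ≤ k ≤ 34, the Cayley graph Cay(F_q, D_k) is a strongly regular graph of degree (q−1)/35, where D_k = ∪_{i=0}^{7^{m−1}−1} C_{5i + k·7^{m−1}}. -/

import Mathlib

section

open Finset

/-- A sum over `range (a * b)`, split according to the residue modulo `a`. -/
lemma sum_range_mul_eq {M : Type*} [AddCommMonoid M] (f : ℕ → M) (a b : ℕ) :
    ∑ i ∈ range (a * b), f i = ∑ i ∈ range a, ∑ j ∈ range b, f (i + a * j) := by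
  rw [sum_comm]
  induction b with
  | zero => simp
  | succ b ih =>
    rw [Nat.mul_succ, sum_range_add, ih, sum_range_succ]
    simp only [add_comm]

/-- The base-`3` digits of `j (3 ^ f - 1) / N`. -/
lemma sum_digits_mul_pow (N j f : ℕ) (hj : j < N) (hf : 3 ^ f % N = 1 % N) :
    j * (3 ^ f - 1) = N * ∑ i ∈ range f, 3 * (j * 3 ^ i % N) / N * 3 ^ (f - 1 - i) := by
  have key : ∀ n ≤ f, j * 3 ^ f = N * (∑ i ∈ range n, 3 * (j * 3 ^ i % N) / N * 3 ^ (f - 1 - i))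
      + (j * 3 ^ n % N) * 3 ^ (f - n) := by
    intro n hn
    induction n with
    | zero => simp [Nat.mod_eq_of_lt hj]
    | succ n ih =>
      rw [ih (by lia), sum_range_succ]
      have h1 : j * 3 ^ (n + 1) % N = 3 * (j * 3 ^ n % N) % N := by
        rw [Nat.mul_mod_mod]; ring_nf
      have h2 := Nat.div_add_mod (3 * (j * 3 ^ n % N)) N
      have h3 : f - n = (f - 1 - n) + 1 := by lia
      have h4 : f - (n + 1) = f - 1 - n := by lia
      rw [h1, h3, h4]
      generalize f - 1 - n = e at *
      generalize ∑ i ∈ range n, 3 * (j * 3 ^ i % N) / N * 3 ^ (f - 1 - i) = S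
      generalize j * 3 ^ n % N = r at *
      rw [pow_succ]
      linear_combination (3 ^ e) * h2.symm
  have h := key f le_rfl
  have h5 : j * 3 ^ f % N = j := by
    rw [Nat.mul_mod, hf, ← Nat.mul_mod, mul_one, Nat.mod_eq_of_lt hj]
  rw [h5, Nat.sub_self, pow_zero, mul_one] at h
  rw [Nat.mul_sub, mul_one, h]
  simp

lemma mul_sum_digits (N j f : ℕ) (hj : j < N) (hf : 3 ^ f % N = 1 % N) :
    N * ∑ i ∈ range f, 3 * (j * 3 ^ i % N) / N = 2 * ∑ i ∈ range f, j * 3 ^ i % N := by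
  have key : ∀ n, N * (∑ i ∈ range n, 3 * (j * 3 ^ i % N) / N) + j * 3 ^ n % N =
      2 * (∑ i ∈ range n, j * 3 ^ i % N) + j := by
    intro n
    induction n with
    | zero => simp [Nat.mod_eq_of_lt hj]
    | succ n ih =>
      rw [sum_range_succ, sum_range_succ]
      have h1 : j * 3 ^ (n + 1) % N = 3 * (j * 3 ^ n % N) % N := by
        rw [Nat.mul_mod_mod]; ring_nf
      have h2 := Nat.div_add_mod (3 * (j * 3 ^ n % N)) N
      rw [h1]
      lia
  have h := key f
  have h5 : j * 3 ^ f % N = j := by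
    rw [Nat.mul_mod, hf, ← Nat.mul_mod, mul_one, Nat.mod_eq_of_lt hj]
  lia

/-- The order of `3 ^ 12` modulo `7 ^ (n + 1)` is `7 ^ n`. -/
lemma seven_pow_dvd_iff (n d : ℕ) : 7 ^ (n + 1) ∣ (3 ^ 12) ^ d - 1 ↔ 7 ^ n ∣ d := by
  rcases Nat.eq_zero_or_pos d with rfl | hd
  · simp
  have : Fact (Nat.Prime 7) := ⟨by norm_num⟩
  have h := padicValNat.pow_sub_pow (p := 7) (x := 3 ^ 12) (y := 1) (by norm_num) (by norm_num)
    (by norm_num) (by norm_num) hd.ne'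
  have h1 : padicValNat 7 (3 ^ 12 - 1) = 1 := by
    rw [show (3 ^ 12 - 1 : ℕ) = 7 * 75920 by norm_num, padicValNat.mul (by norm_num) (by norm_num),
      padicValNat.self (by norm_num), padicValNat.eq_zero_of_not_dvd (by norm_num)]
  rw [one_pow, h1] at h
  have h2 : (3 ^ 12) ^ d - 1 ≠ 0 := by
    have : 1 < (3 ^ 12) ^ d := Nat.one_lt_pow hd.ne' (by norm_num)
    lia
  rw [padicValNat_dvd_iff_le h2, padicValNat_dvd_iff_le hd.ne', h]
  lia

lemma three_pow_mod (n : ℕ) : 3 ^ (12 * 7 ^ n) % (7 ^ (n + 1) * 5) = 1 % (7 ^ (n + 1) * 5) := by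
  have h7 : 7 ^ (n + 1) ∣ 3 ^ (12 * 7 ^ n) - 1 := by
    rw [pow_mul, seven_pow_dvd_iff]
  have h5 : 5 ∣ 3 ^ (12 * 7 ^ n) - 1 := by
    rw [pow_mul]
    have h := Nat.sub_dvd_pow_sub_pow (3 ^ 12) 1 (7 ^ n)
    rw [one_pow] at h
    exact (by norm_num : 5 ∣ 3 ^ 12 - 1).trans h
  have hc : Nat.Coprime (7 ^ (n + 1)) 5 := Nat.Coprime.pow_left _ (by norm_num)
  exact ((Nat.modEq_iff_dvd' (Nat.one_le_pow _ _ (by norm_num))).2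
    (hc.mul_dvd_of_dvd_of_dvd h7 h5)).symm

lemma sum_block (n j i : ℕ) (hj : ¬ 7 ∣ j) :
    2 * ∑ l ∈ range (7 ^ n), j * 3 ^ (i + 12 * l) % (7 ^ (n + 1) * 5) =
      7 ^ n * (2 * (j * 3 ^ i % 35)) + 35 * (7 ^ n * (7 ^ n - 1)) := by
  set N := 7 ^ (n + 1) * 5 with hN
  have hN' : N = 35 * 7 ^ n := by rw [hN]; ring
  set r : ℕ → ℕ := fun l ↦ j * 3 ^ (i + 12 * l) % N with hr
  have hNpos : 0 < N := by positivity
  have hmod : ∀ l, r l % 35 = j * 3 ^ i % 35 := by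
    intro l
    rw [hr]
    simp only
    rw [Nat.mod_mod_of_dvd _ ⟨7 ^ n, hN'⟩, pow_add, pow_mul, ← mul_assoc, Nat.mul_mod, Nat.pow_mod]
    norm_num
  have hlt : ∀ l, r l / 35 < 7 ^ n := fun l ↦ by
    rw [Nat.div_lt_iff_lt_mul (by norm_num), mul_comm, ← hN']
    exact Nat.mod_lt _ hNpos
  have aux : ∀ a b, a ≤ b → b < 7 ^ n → r a = r b → a = b := by
    intro a b hab hb h
    have h1 : N ∣ j * 3 ^ (i + 12 * b) - j * 3 ^ (i + 12 * a) :=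
      (Nat.modEq_iff_dvd' (by gcongr; norm_num)).1 h
    have h2 : j * 3 ^ (i + 12 * b) - j * 3 ^ (i + 12 * a) =
        (j * 3 ^ (i + 12 * a)) * ((3 ^ 12) ^ (b - a) - 1) := by
      rw [Nat.mul_sub, mul_one, mul_assoc, ← pow_mul, ← pow_add,
        show i + 12 * a + 12 * (b - a) = i + 12 * b by lia]
    rw [h2] at h1
    have h3 : Nat.Coprime (7 ^ (n + 1)) (j * 3 ^ (i + 12 * a)) := by
      apply Nat.Coprime.pow_left
      apply Nat.Coprime.mul_right
      · exact (Nat.Prime.coprime_iff_not_dvd (by norm_num)).2 hj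
      · exact Nat.Coprime.pow_right _ (by norm_num)
    have h4 := h3.dvd_of_dvd_mul_left ((Dvd.intro _ rfl : 7 ^ (n + 1) ∣ N).trans h1)
    rw [seven_pow_dvd_iff] at h4
    have := Nat.eq_zero_of_dvd_of_lt h4 (by lia)
    lia
  have hinj : Set.InjOn (fun l ↦ r l / 35) (range (7 ^ n) : Set ℕ) := by
    intro a ha b hb h
    have hab : r a = r b := by
      rw [← Nat.div_add_mod (r a) 35, ← Nat.div_add_mod (r b) 35, hmod, hmod]
      simp only at h
      rw [h]
    simp only [coe_range, Set.mem_Iio] at ha hb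
    rcases le_total a b with hle | hle
    · exact aux a b hle hb hab
    · exact (aux b a hle ha hab.symm).symm
  have himg : (range (7 ^ n)).image (fun l ↦ r l / 35) = range (7 ^ n) := by
    apply eq_of_subset_of_card_le
    · intro x hx
      obtain ⟨l, -, rfl⟩ := mem_image.1 hx
      exact mem_range.2 (hlt l)
    · rw [card_image_of_injOn hinj]
  have hsum : ∑ l ∈ range (7 ^ n), r l / 35 = ∑ l ∈ range (7 ^ n), l := by
    conv_rhs => rw [← himg]
    rw [sum_image hinj]
  have : ∀ l, r l = 35 * (r l / 35) + j * 3 ^ i % 35 := fun l ↦ by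
    rw [← hmod l, Nat.div_add_mod]
  calc 2 * ∑ l ∈ range (7 ^ n), r l
      = 2 * ∑ l ∈ range (7 ^ n), (35 * (r l / 35) + j * 3 ^ i % 35) := by
        rw [sum_congr rfl fun l _ ↦ this l]
    _ = _ := by
        rw [sum_add_distrib, ← mul_sum, hsum, ← sum_range_id_mul_two]
        simp
        ring

lemma sum_mod_thirtyfive (j : ℕ) (hj : ¬ 7 ∣ j) : ∑ i ∈ range 12, j * 3 ^ i % 35 ≤ 245 := by
  have h : ∀ j < 35, ¬ 7 ∣ j → ∑ i ∈ range 12, j * 3 ^ i % 35 ≤ 245 := by decide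
  have := h (j % 35) (Nat.mod_lt _ (by norm_num)) (by lia)
  simpa only [Nat.mod_mul_mod] using this

lemma sum_mod_le (n j : ℕ) (hj : ¬ 7 ∣ j ∨ 7 ^ (n + 1) ∣ j) :
    ∑ i ∈ range (12 * 7 ^ n), j * 3 ^ i % (7 ^ (n + 1) * 5) ≤
      7 ^ (n + 1) * 5 * (6 * 7 ^ n + 1) := by
  have h7 : 1 ≤ 7 ^ n := Nat.one_le_pow _ _ (by norm_num)
  rw [sum_range_mul_eq]
  rcases hj with hj | ⟨j, rfl⟩
  · have h1 : 2 * ∑ i ∈ range 12, ∑ l ∈ range (7 ^ n), j * 3 ^ (i + 12 * l) % (7 ^ (n + 1) * 5) =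
        7 ^ n * (2 * ∑ i ∈ range 12, j * 3 ^ i % 35) + 12 * (35 * (7 ^ n * (7 ^ n - 1))) := by
      rw [mul_sum, sum_congr rfl fun i _ ↦ sum_block n j i hj, sum_add_distrib, ← mul_sum,
        ← mul_sum]
      simp
    have h2 := sum_mod_thirtyfive j hj
    obtain ⟨k, hk⟩ := Nat.exists_eq_add_of_le h7
    rw [pow_succ]
    rw [pow_succ] at h1
    rw [hk] at h1 ⊢
    simp only [Nat.add_sub_cancel_left] at h1
    have h3 := Nat.mul_le_mul_left (1 + k) h2
    nlinarith
  · have h1 : ∀ i l, 7 ^ (n + 1) * j * 3 ^ (i + 12 * l) % (7 ^ (n + 1) * 5) =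
        7 ^ (n + 1) * (j * 3 ^ i % 5) := by
      intro i l
      rw [mul_assoc, Nat.mul_mod_mul_left, pow_add 3 i, pow_mul, ← mul_assoc j, Nat.mul_mod (j * _),
        Nat.pow_mod]
      norm_num
    have h2 : ∑ i ∈ range 12, j * 3 ^ i % 5 ≤ 30 := by
      have h : ∀ j < 5, ∑ i ∈ range 12, j * 3 ^ i % 5 ≤ 30 := by decide
      have := h (j % 5) (Nat.mod_lt _ (by norm_num))
      simpa only [Nat.mod_mul_mod] using this
    simp only [h1, sum_const, card_range, smul_eq_mul, ← mul_sum]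
    have h3 := Nat.mul_le_mul_left (7 ^ n * 7 ^ (n + 1)) h2
    nlinarith [Nat.zero_le (7 ^ (n + 1))]

lemma sum_digits_le (n j : ℕ) (hj : j < 7 ^ (n + 1) * 5) (h : ¬ 7 ∣ j ∨ 7 ^ (n + 1) ∣ j) :
    ∑ i ∈ range (12 * 7 ^ n), 3 * (j * 3 ^ i % (7 ^ (n + 1) * 5)) / (7 ^ (n + 1) * 5) ≤
      12 * 7 ^ n + 2 := by
  have h1 := mul_sum_digits _ j _ hj (three_pow_mod n)
  have h2 := sum_mod_le n j h
  refine Nat.le_of_mul_le_mul_left ?_ (by positivity : 0 < 7 ^ (n + 1) * 5)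
  rw [h1]
  linarith

section GaussSum

variable {F R : Type*} [Field F] [Fintype F] [CommRing R] [IsDomain R]

lemma gaussSum_mul_dvd {ψ : AddChar F R} (hψ : ψ ≠ 1) (χ φ : MulChar F R) :
    gaussSum (χ * φ) ψ ∣ gaussSum χ ψ * gaussSum φ ψ := by
  by_cases h : χ * φ = 1
  · rw [h, gaussSum_one_left hψ]
    exact (isUnit_one.neg).dvd
  · exact ⟨_, (jacobiSum_mul_nontrivial h ψ).symm⟩

lemma gaussSum_pow_dvd {ψ : AddChar F R} (hψ : ψ ≠ 1) (χ : MulChar F R) (n : ℕ) :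
    gaussSum (χ ^ n) ψ ∣ gaussSum χ ψ ^ n := by
  induction n with
  | zero => rw [pow_zero, gaussSum_one_left hψ]; exact (isUnit_one.neg).dvd
  | succ n ih =>
    rw [pow_succ, pow_succ]
    exact (gaussSum_mul_dvd hψ _ _).trans (mul_dvd_mul_right ih _)

omit [IsDomain R] in
lemma gaussSum_pow_char_pow (p : ℕ) [Fact p.Prime] [CharP F p] {ψ : AddChar F R}
    (hψ : ∀ x, ψ (x ^ p) = ψ x) (χ : MulChar F R) (i : ℕ) :
    gaussSum (χ ^ p ^ i) ψ = gaussSum χ ψ := by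
  induction i with
  | zero => simp
  | succ i ih =>
    rw [← ih, gaussSum, gaussSum]
    refine Fintype.sum_equiv (frobeniusEquiv F p).toEquiv _ _ fun x ↦ ?_
    have hp : p ≠ 0 := (Fact.out : p.Prime).ne_zero
    simp only [RingEquiv.toEquiv_eq_coe, EquivLike.coe_coe, frobeniusEquiv_apply,
      frobenius_def, hψ]
    rw [MulChar.pow_apply' _ (by positivity), MulChar.pow_apply' _ (by positivity), map_pow,
      ← pow_mul, pow_succ']

/-- Upper half of Stickelberger's theorem: the Gauss sum of a power of `χ` divides the power of
the Gauss sum of `χ` whose exponent is the sum of the digits. -/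
lemma gaussSum_pow_sum_dvd (p : ℕ) [Fact p.Prime] [CharP F p] {ψ : AddChar F R} (hψ : ψ ≠ 1)
    (hψp : ∀ x, ψ (x ^ p) = ψ x) (χ : MulChar F R) (s : Finset ℕ) (d e : ℕ → ℕ) :
    gaussSum (χ ^ ∑ i ∈ s, d i * p ^ e i) ψ ∣ gaussSum χ ψ ^ ∑ i ∈ s, d i := by
  classical
  induction s using Finset.induction_on with
  | empty => simpa using gaussSum_pow_dvd hψ χ 0
  | insert a s ha ih =>
    rw [sum_insert ha, sum_insert ha, pow_add, pow_add]
    refine (gaussSum_mul_dvd hψ _ _).trans (mul_dvd_mul ?_ ih)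
    rw [mul_comm, pow_mul]
    refine (gaussSum_pow_dvd hψ _ _).trans ?_
    rw [gaussSum_pow_char_pow p hψp]

/-- Lower half of Stickelberger's theorem, deduced from the upper half for the inverse. -/
lemma pow_dvd_gaussSum {ψ : AddChar F R} (hψ : ψ ≠ 1) {χ : MulChar F R} (hχ : χ ≠ 1) {ϖ u : R}
    (hϖ : ϖ ≠ 0) {a b : ℕ} (hq : (Fintype.card F : R) = ϖ ^ (a + b) * u)
    (h : gaussSum χ⁻¹ ψ ∣ ϖ ^ a) : ϖ ^ b ∣ gaussSum χ ψ := by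
  obtain ⟨w, hw⟩ := h
  have h1 := gaussSum_mul_gaussSum_eq_card hχ (AddChar.IsPrimitive.of_ne_one hψ)
  have h2 := mul_gaussSum_inv_eq_gaussSum χ⁻¹ ψ
  have h4 : χ⁻¹ (-1) = χ (-1) := by rw [MulChar.inv_apply']; congr 1; rw [inv_neg, inv_one]
  refine ⟨χ (-1) * u * w, mul_left_cancel₀ (pow_ne_zero a hϖ) ?_⟩
  rw [h4] at h2
  rw [pow_add] at hq
  linear_combination (gaussSum χ ψ) * hw - gaussSum χ ψ * w * h2 + χ (-1) * w * h1 +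
    χ (-1) * w * hq

end GaussSum


section Witt

open WittVector

variable (F : Type) [Field F] [Fintype F] [CharP F 3]

variable {F} in
omit [Fintype F] in
lemma three_pow_dvd_of_witt (n : ℕ) (z : ℤ) (h : (3 : WittVector 3 F) ^ n ∣ z) :
    (3 : ℤ) ^ n ∣ z := by
  induction n generalizing z with
  | zero => simp
  | succ n ih =>
    obtain ⟨w, hw⟩ := h
    have h3 : (3 : WittVector 3 F) ≠ 0 := by exact_mod_cast WittVector.p_nonzero 3 F
    have h3F : (3 : F) = 0 := by exact_mod_cast CharP.cast_eq_zero F 3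
    have hz : (z : F) = 0 := by
      have := congr_arg (constantCoeff (p := 3) (R := F)) hw
      rwa [map_intCast, map_mul, map_pow, map_ofNat, h3F, zero_pow n.succ_ne_zero, zero_mul] at this
    obtain ⟨z', rfl⟩ := (CharP.intCast_eq_zero_iff F 3 z).1 hz
    have : (z' : WittVector 3 F) = 3 ^ n * w := by
      apply mul_left_cancel₀ h3
      push_cast at hw
      rw [hw]
      ring
    rw [pow_succ']
    exact mul_dvd_mul_left _ (ih z' ⟨w, this⟩)

lemma pow_dvd_of_isIntegral {W L K : Type*} [CommRing W] [IsDomain W] [IsIntegrallyClosed W]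
    [Field L] [Algebra W L] [IsFractionRing W L] [Field K] [Algebra L K] [Algebra W K]
    [IsScalarTower W L K] (a : ℕ) (n : ℕ) (z : ℤ) (ha : (a : L) ≠ 0) {r : K} (hr : IsIntegral W r)
    (h : (z : K) = (a : K) ^ n * r) : (a : W) ^ n ∣ z := by
  have haK : (a : K) ≠ 0 := by simpa using (algebraMap L K).injective.ne ha
  have hy : algebraMap L K ((z : L) / a ^ n) = r := by
    simp only [map_div₀, map_intCast, map_pow, map_natCast]
    rw [h, mul_div_cancel_left₀ _ (pow_ne_zero n haK)]
  have hint : IsIntegral W ((z : L) / a ^ n) := by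
    rw [← isIntegral_algebraMap_iff (algebraMap L K).injective, hy]
    exact hr
  obtain ⟨w, hw⟩ := IsIntegrallyClosed.isIntegral_iff.1 hint
  refine ⟨w, IsFractionRing.injective W L ?_⟩
  simp only [map_intCast, map_mul, map_pow, map_natCast]
  rw [hw, mul_div_cancel₀ _ (pow_ne_zero n ha)]

variable {F} in
/-- The Gauss sum of the inverse Teichmüller character divides `1 - ζ`. -/
lemma gaussSum_dvd_one_sub [Algebra (ZMod 3) F] {R : Type*} [CommRing R] [IsDomain R]
    (f : WittVector 3 F →+* R) {τ : MulChar F R} (hτ : ∀ x, τ x = f (teichmuller 3 x⁻¹))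
    (hτ1 : ∀ x, τ x = 1 → x = 1) {ζ : R} (hζ : 1 + ζ + ζ ^ 2 = 0) (tr : F →+ ZMod 3)
    (htr : ∀ x, algebraMap (ZMod 3) F (tr x) =
      ∑ i ∈ range (Module.finrank (ZMod 3) F), x ^ 3 ^ i)
    (hcard : Fintype.card F = 3 ^ Module.finrank (ZMod 3) F)
    (ψ : AddChar F R) (hψ : ∀ x, ψ x = ζ ^ (tr x).val) : gaussSum τ ψ ∣ 1 - ζ := by
  classical
  let W := WittVector 3 F
  have h3F : (3 : F) = 0 := by exact_mod_cast CharP.cast_eq_zero F 3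
  have hζ3 : ζ ^ 3 = 1 := by linear_combination (ζ - 1) * hζ
  let α : ZMod 3 → W := ![0, 1, 1]
  let β : ZMod 3 → W := ![0, 0, 1]
  set A : W := ∑ x : F, teichmuller 3 x⁻¹ * α (tr x) with hA
  set B : W := ∑ x : F, teichmuller 3 x⁻¹ * β (tr x) with hB
  have hab : ∀ t : ZMod 3, ζ ^ t.val - 1 = (ζ - 1) * (f (α t) + f (β t) * ζ) := by
    intro t
    fin_cases t
    · simp [α, β, ZMod.val]
    · simp [α, β, ZMod.val]
    · simp [α, β, ZMod.val]; ring
  have hτne : τ ≠ 1 := by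
    intro h
    have h1 := hτ1 (-1) (by rw [h, MulChar.one_apply (isUnit_one.neg)])
    exact one_ne_zero (α := F) (by linear_combination h3F + h1)
  have hg : gaussSum τ ψ = (ζ - 1) * (f A + f B * ζ) := by
    have h1 : gaussSum τ ψ = ∑ x, τ x * (ψ x - 1) := by
      simp only [mul_sub, mul_one, sum_sub_distrib, MulChar.sum_eq_zero_of_ne_one hτne, sub_zero]
      rfl
    rw [h1, hA, hB, map_sum, map_sum, sum_mul, ← sum_add_distrib, mul_sum]
    refine sum_congr rfl fun x _ ↦ ?_
    rw [hψ, hab, hτ, map_mul, map_mul]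
    ring
  have hcoeff : constantCoeff (A + B) = (-1 : F) := by
    have hα : ∀ t : ZMod 3, constantCoeff (α t + β t) = algebraMap (ZMod 3) F t := by
      intro t
      fin_cases t
      · change constantCoeff (0 + 0 : W) = algebraMap (ZMod 3) F 0
        simp only [map_zero, add_zero]
      · change constantCoeff (1 + 0 : W) = algebraMap (ZMod 3) F 1
        simp only [map_one, add_zero]
      · change constantCoeff (1 + 1 : W) = algebraMap (ZMod 3) F (1 + 1)
        simp only [map_add, map_one]
    have h1 : constantCoeff (A + B) =
        ∑ x : F, x⁻¹ * ∑ i ∈ range (Module.finrank (ZMod 3) F), x ^ 3 ^ i := by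
      rw [hA, hB, ← sum_add_distrib, map_sum]
      refine sum_congr rfl fun x _ ↦ ?_
      rw [← mul_add, map_mul, hα, htr]
      rw [show constantCoeff (teichmuller 3 x⁻¹) = x⁻¹ from teichmuller_coeff_zero 3 _]
    rw [h1]
    simp only [mul_sum]
    rw [sum_comm]
    have hpos : 0 < Module.finrank (ZMod 3) F := Module.finrank_pos
    have h2 : ∀ i ∈ range (Module.finrank (ZMod 3) F), i ≠ 0 →
        ∑ x : F, x⁻¹ * x ^ 3 ^ i = 0 := by
      intro i hi hi0
      have hlt : 3 ^ i < 3 ^ Module.finrank (ZMod 3) F :=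
        Nat.pow_lt_pow_right (by norm_num) (mem_range.1 hi)
      have hgt : 3 ^ 1 ≤ 3 ^ i := Nat.pow_le_pow_right (by norm_num) (by lia)
      rw [← FiniteField.sum_pow_lt_card_sub_one F (3 ^ i - 1) (by rw [hcard]; lia)]
      refine sum_congr rfl fun x _ ↦ ?_
      rcases eq_or_ne x 0 with rfl | hx
      · rw [inv_zero, zero_mul, zero_pow (by lia)]
      · obtain ⟨k, hk⟩ : ∃ k, 3 ^ i = k + 1 := ⟨3 ^ i - 1, by lia⟩
        rw [hk, Nat.add_sub_cancel, pow_succ]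
        field_simp
    rw [sum_eq_single_of_mem 0 (mem_range.2 hpos) h2]
    have h3 : ∑ x : F, x⁻¹ * x ^ 3 ^ 0 = ∑ x : F, (1 - if x = 0 then 1 else 0) := by
      refine sum_congr rfl fun x _ ↦ ?_
      rcases eq_or_ne x 0 with rfl | hx
      · simp
      · simp [hx]
    rw [h3, sum_sub_distrib]
    simp
  have hunit : IsUnit (A ^ 2 - A * B + B ^ 2) := by
    apply isUnit_of_coeff_zero_ne_zero
    have h1 : constantCoeff (A ^ 2 - A * B + B ^ 2) = (1 : F) := by
      have : A ^ 2 - A * B + B ^ 2 = (A + B) ^ 2 - 3 * (A * B) := by ring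
      rw [this, map_sub, map_pow, hcoeff, map_mul, map_ofNat, h3F]
      ring
    change constantCoeff (A ^ 2 - A * B + B ^ 2) ≠ 0
    rw [h1]
    exact one_ne_zero
  obtain ⟨v, hv⟩ := hunit.exists_right_inv
  refine ⟨-(f A + f B * ζ ^ 2) * f v, ?_⟩
  have hv' := congr_arg (f) hv
  simp only [map_mul, map_add, map_sub, map_pow, map_one] at hv'
  rw [hg]
  generalize f A = a at *
  generalize f B = b at *
  generalize f v = v' at *
  linear_combination (ζ - 1) * hv' + (ζ - 1) * v' * (a * b * hζ + b ^ 2 * hζ3)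

/-- The data needed for Stickelberger's theorem over a finite field of characteristic three:
a ring `R` containing a cube root of unity `ζ`, in which `3` still is no unit, the inverse `τ` of
the Teichmüller character, and the additive character `x ↦ ζ ^ tr x`. -/
lemma exists_teichmuller_data : ∃ (R : Type) (_ : CommRing R) (_ : IsDomain R)
    (τ : MulChar F R) (ζ : R) (tr : F →+ ZMod 3) (ψ : AddChar F R),
    (∀ x, τ x = 1 → x = 1) ∧ 1 + ζ + ζ ^ 2 = 0 ∧ (∀ x, ψ x = ζ ^ (tr x).val) ∧
    (∀ x, tr (x ^ 3) = tr x) ∧ (∃ x, tr x ≠ 0) ∧ gaussSum τ ψ ∣ 1 - ζ ∧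
    ∀ (n : ℕ) (z : ℤ), (3 : R) ^ n ∣ z → (3 : ℤ) ^ n ∣ z := by
  classical
  let W := WittVector 3 F
  let L := FractionRing W
  let K := AlgebraicClosure L
  let R := integralClosure W K
  have hWK : Function.Injective (algebraMap W K) := by
    rw [IsScalarTower.algebraMap_eq W L K]
    exact (algebraMap L K).injective.comp (IsFractionRing.injective W L)
  have hWR : Function.Injective (algebraMap W R) := fun a b h ↦ hWK (congr_arg Subtype.val h)
  have h3W : (3 : W) ≠ 0 := by exact_mod_cast WittVector.p_nonzero 3 F
  have h3F : (3 : F) = 0 := by exact_mod_cast CharP.cast_eq_zero F 3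
  -- the multiplicative character
  let τ : MulChar F R :=
    { toFun := fun x ↦ algebraMap W R (teichmuller 3 x⁻¹)
      map_one' := by simp
      map_mul' := fun x y ↦ by simp [mul_comm]
      map_nonunit' := fun x hx ↦ by
        have : x = 0 := by simpa using hx
        simp [this] }
  have hτ : ∀ x, τ x = algebraMap W R (teichmuller 3 x⁻¹) := fun _ ↦ rfl
  have hτ1 : ∀ x, τ x = 1 → x = 1 := by
    intro x hx
    rw [hτ, ← map_one (algebraMap W R)] at hx
    have := congr_arg (fun w : W ↦ w.coeff 0) (hWR hx)
    simpa using this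
  -- the cube root of unity
  obtain ⟨z, hz⟩ : ∃ z : K, 1 + z + z ^ 2 = 0 := by
    obtain ⟨z, hz⟩ := IsAlgClosed.exists_root (Polynomial.X ^ 2 + Polynomial.X + 1 : Polynomial K)
      (by
        have : (Polynomial.X ^ 2 + Polynomial.X + 1 : Polynomial K).degree = 2 := by compute_degree!
        rw [this]; norm_num)
    exact ⟨z, by simp [Polynomial.IsRoot] at hz; linear_combination hz⟩
  have hzint : IsIntegral W z :=
    ⟨Polynomial.X ^ 2 + Polynomial.X + 1, by monicity!, by simp; linear_combination hz⟩
  let ζ : R := ⟨z, hzint⟩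
  have hζ : 1 + ζ + ζ ^ 2 = 0 := Subtype.ext hz
  have hζ3 : ζ ^ 3 = 1 := by linear_combination (ζ - 1) * hζ
  -- the additive character
  let _ : Algebra (ZMod 3) F := ZMod.algebra F 3
  let tr : F →+ ZMod 3 := (Algebra.trace (ZMod 3) F).toAddMonoidHom
  have htr : ∀ x, algebraMap (ZMod 3) F (tr x) =
      ∑ i ∈ range (Module.finrank (ZMod 3) F), x ^ 3 ^ i := by
    intro x
    have := FiniteField.algebraMap_trace_eq_sum_pow (ZMod 3) F x
    rw [Nat.card_zmod] at this
    exact this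
  have hcard : Fintype.card F = 3 ^ Module.finrank (ZMod 3) F := by
    simpa using Module.card_eq_pow_finrank (K := ZMod 3) (V := F)
  let ψ : AddChar F R := (AddChar.zmodChar 3 hζ3).compAddMonoidHom tr
  have hψ : ∀ x, ψ x = ζ ^ (tr x).val := fun x ↦ rfl
  refine ⟨R, inferInstance, inferInstance, τ, ζ, tr, ψ, hτ1, hζ, hψ, ?_, ?_, ?_, ?_⟩
  · intro x
    apply (algebraMap (ZMod 3) F).injective
    rw [htr, htr]
    have h1 : ∑ i ∈ range (Module.finrank (ZMod 3) F), (x ^ 3) ^ 3 ^ i =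
        ∑ i ∈ range (Module.finrank (ZMod 3) F), x ^ 3 ^ (i + 1) := by
      refine sum_congr rfl fun i _ ↦ ?_
      rw [← pow_mul, pow_succ']
    have h2 := sum_range_succ' (fun i ↦ x ^ 3 ^ i) (Module.finrank (ZMod 3) F)
    have h3 := sum_range_succ (fun i ↦ x ^ 3 ^ i) (Module.finrank (ZMod 3) F)
    rw [h1]
    have h4 : x ^ 3 ^ Module.finrank (ZMod 3) F = x := by
      rw [← hcard, FiniteField.pow_card]
    rw [h2] at h3
    simp only [h4, pow_zero, pow_one] at h3
    exact add_right_cancel h3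
  · obtain ⟨x, hx⟩ := Algebra.trace_surjective (ZMod 3) F 1
    exact ⟨x, by change Algebra.trace (ZMod 3) F x ≠ 0; rw [hx]; exact one_ne_zero⟩
  · exact gaussSum_dvd_one_sub (algebraMap W R) hτ hτ1 hζ tr htr hcard ψ hψ
  · rintro n z ⟨r, hr⟩
    refine three_pow_dvd_of_witt (F := F) n z
      (pow_dvd_of_isIntegral (L := L) (K := K) 3 n z ?_ r.2 ?_)
    · have := (IsFractionRing.injective W L).ne h3W
      rw [map_ofNat, map_zero] at this
      exact_mod_cast this
    · have := congr_arg (algebraMap R K) hr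
      rw [map_intCast, map_mul, map_pow, map_ofNat] at this
      exact_mod_cast this

end Witt

section TwoValues

/-- The function counting representations of `z` as a sum of two elements of `D`. -/
def sumRep {F : Type*} [AddCommGroup F] [DecidableEq F] (D : Finset F) (z : F) : ℕ :=
  #{x ∈ D | z - x ∈ D}

variable {F R : Type*} [Field F] [Fintype F] [DecidableEq F] [CommRing R] [IsDomain R]

lemma sum_charSum_mul {ψ : AddChar F R} (hψ : ψ ≠ 1) (D : Finset F) (z : F) :
    ∑ b, (∑ x ∈ D, ψ (b * x)) * ψ (-(b * z)) = if z ∈ D then (Fintype.card F : R) else 0 := by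
  have h : ∀ x b, ψ (b * x) * ψ (-(b * z)) = ψ (b * (x - z)) := fun x b ↦ by
    rw [← AddChar.map_add_eq_mul]; congr 1; ring
  simp only [sum_mul, h]
  rw [sum_comm]
  simp only [AddChar.sum_mulShift _ (AddChar.IsPrimitive.of_ne_one hψ), sub_eq_zero]
  simp

lemma sum_charSum_sq_mul {ψ : AddChar F R} (hψ : ψ ≠ 1) (D : Finset F) (z : F) :
    ∑ b, (∑ x ∈ D, ψ (b * x)) ^ 2 * ψ (-(b * z)) = Fintype.card F * sumRep D z := by
  have h : ∀ x y b, ψ (b * x) * ψ (b * y) * ψ (-(b * z)) = ψ (b * (y - (z - x))) := fun x y b ↦ by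
    rw [← AddChar.map_add_eq_mul, ← AddChar.map_add_eq_mul]; congr 1; ring
  have h' : ∀ b, (∑ x ∈ D, ψ (b * x)) ^ 2 * ψ (-(b * z)) =
      ∑ x ∈ D, ∑ y ∈ D, ψ (b * (y - (z - x))) := fun b ↦ by
    rw [sq, sum_mul_sum, sum_mul]
    refine sum_congr rfl fun x _ ↦ ?_
    rw [sum_mul]
    exact sum_congr rfl fun y _ ↦ h x y b
  simp only [h']
  rw [sum_comm]
  have h1 : ∀ x ∈ D, ∑ b, ∑ y ∈ D, ψ (b * (y - (z - x))) =
      if z - x ∈ D then (Fintype.card F : R) else 0 := by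
    intro x _
    rw [sum_comm]
    simp only [AddChar.sum_mulShift _ (AddChar.IsPrimitive.of_ne_one hψ),
      sub_eq_zero (b := z - x)]
    simp
  rw [sum_congr rfl h1, sum_ite, sumRep]
  simp [mul_comm]

omit [Fintype F] [DecidableEq F] [IsDomain R] in
/-- A sum of cube roots of unity over a symmetric set is an integer. -/
lemma exists_int_charSum {ζ : R} (hζ : 1 + ζ + ζ ^ 2 = 0) (tr : F →+ ZMod 3)
    (ψ : AddChar F R) (hψ : ∀ x, ψ x = ζ ^ (tr x).val) {D : Finset F} (hD : ∀ x ∈ D, -x ∈ D)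
    (b : F) : ∃ t : ℤ, ∑ x ∈ D, ψ (b * x) = t := by
  have h1 : ∀ t : ZMod 3, ζ ^ t.val =
      (if t = 0 then 1 else 0) + (if t = 1 then ζ else 0) + (if t = -1 then ζ ^ 2 else 0) := by
    intro t
    have e : ∀ t : ZMod 3, t = 0 ∨ t = 1 ∨ t = -1 := by decide
    have h01 : (0 : ZMod 3) ≠ 1 := by decide
    have h02 : (0 : ZMod 3) ≠ -1 := by decide
    have h12 : (1 : ZMod 3) ≠ -1 := by decide
    have v2 : (-1 : ZMod 3).val = 2 := by decide
    rcases e t with rfl | rfl | rfl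
    · simp [h01, h02]
    · simp [h01.symm, h12, ZMod.val_one]
    · simp only [h02.symm, h12.symm, v2, if_true, if_false, zero_add]
  have h2 : #{x ∈ D | tr (b * x) = 1} = #{x ∈ D | tr (b * x) = -1} := by
    refine card_bij' (fun x _ ↦ -x) (fun x _ ↦ -x) ?_ ?_ (by simp) (by simp)
    · intro x hx
      simp only [mem_filter] at hx ⊢
      exact ⟨hD x hx.1, by rw [mul_neg, map_neg, hx.2]⟩
    · intro x hx
      simp only [mem_filter] at hx ⊢
      exact ⟨hD x hx.1, by rw [mul_neg, map_neg, hx.2, neg_neg]⟩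
  refine ⟨#{x ∈ D | tr (b * x) = 0} - #{x ∈ D | tr (b * x) = 1}, ?_⟩
  simp only [hψ, h1, sum_add_distrib, ← sum_filter, sum_const, nsmul_eq_mul]
  rw [← h2]
  push_cast
  linear_combination (#{x ∈ D | tr (b * x) = 1} : R) * hζ

/-- If the character sums of `D` are integers in the prescribed residue class modulo `Q`, then
the first two moments force them to take only two values. -/
lemma charSum_two_values {ψ : AddChar F R} (hψ : ψ ≠ 1)
    (hinj : Function.Injective (Int.cast : ℤ → R)) {D : Finset F} (h0 : 0 ∉ D)
    (hD : ∀ x ∈ D, -x ∈ D) {Q : ℤ} (hQ0 : Q ≠ 0) (hQ : Q % 35 = 33)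
    (hq : (Fintype.card F : ℤ) = 9 * Q ^ 2) (hcard : 35 * (#D : ℤ) = Fintype.card F - 1)
    {θ : F → ℤ} (hθ : ∀ b, ∑ x ∈ D, ψ (b * x) = θ b) (hdvd : ∀ b ≠ 0, Q ∣ 35 * θ b + 1)
    (b : F) (hb : b ≠ 0) : (35 * θ b + 1 - 17 * Q) * (35 * θ b + 1 + 18 * Q) = 0 := by
  have hθ0 : θ 0 = #D := hinj (by rw [← hθ]; simp)
  have m1 : ∑ b, θ b = 0 := by
    apply hinj
    have := sum_charSum_mul hψ D 0
    simp only [mul_zero, neg_zero, AddChar.map_zero_eq_one, mul_one, hθ, if_neg h0] at this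
    push_cast
    exact this
  have m2 : ∑ b, θ b ^ 2 = Fintype.card F * #D := by
    apply hinj
    have := sum_charSum_sq_mul hψ D 0
    have hs : sumRep D 0 = #D := by
      rw [sumRep, filter_true_of_mem]
      intro x hx
      rw [zero_sub]
      exact hD x hx
    simp only [mul_zero, neg_zero, AddChar.map_zero_eq_one, mul_one, hθ, hs] at this
    push_cast
    exact this
  set g : F → ℤ := fun b ↦ (35 * θ b + 1 - 17 * Q) * (35 * θ b + 1 + 18 * Q) with hg
  have hnonneg : ∀ b ≠ 0, 0 ≤ g b := by
    intro b hb
    obtain ⟨y, hy⟩ := hdvd b hb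
    obtain ⟨k, hk⟩ : ∃ k, y = 17 + 35 * k := by
      have h1 : Q * y % 35 = 1 := by lia
      rw [Int.mul_emod, hQ] at h1
      exact ⟨(y - 17) / 35, by lia⟩
    have h2 : g b = (35 * Q) ^ 2 * (k * (k + 1)) := by
      simp only [hg, hy, hk]
      ring
    rw [h2]
    have : 0 ≤ k * (k + 1) := by
      rcases le_or_gt 0 k with h | h
      · positivity
      · nlinarith
    positivity
  have hsum : ∑ b, g b = g 0 := by
    have h1 : ∀ b, g b = 1225 * θ b ^ 2 + (70 + 35 * Q) * θ b + (1 - 17 * Q) * (1 + 18 * Q) :=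
      fun b ↦ by simp only [hg]; ring
    have h2 : ∑ b, g b = 1225 * (Fintype.card F * #D) +
        Fintype.card F * ((1 - 17 * Q) * (1 + 18 * Q)) := by
      simp only [h1, sum_add_distrib, ← mul_sum, m1, m2, sum_const, card_univ, nsmul_eq_mul]
      ring
    rw [h2]
    simp only [hg, hθ0]
    rw [hcard]
    have : 1225 * ((Fintype.card F : ℤ) * #D) = 35 * Fintype.card F * (Fintype.card F - 1) := by
      rw [← hcard]; ring
    rw [this, hq]
    ring
  have hsum' : ∑ b ∈ univ.erase 0, g b = 0 := by
    have := add_sum_erase univ g (mem_univ 0)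
    linarith
  exact (sum_eq_zero_iff_of_nonneg fun b hb ↦ hnonneg b (ne_of_mem_erase hb)).1 hsum' b
    (mem_erase.2 ⟨hb, mem_univ b⟩)

/-- If the nontrivial character sums of `D` are roots of one quadratic polynomial, then the number
of representations of `z ≠ 0` as a sum of two elements of `D` depends only on `z ∈ D`. -/
lemma sumRep_eq {ψ : AddChar F R} (hψ : ψ ≠ 1) (hinj : Function.Injective (Int.cast : ℤ → R))
    {D : Finset F} {θ : F → ℤ} (hθ : ∀ b, ∑ x ∈ D, ψ (b * x) = θ b) {r s t : ℤ} (hr : r ≠ 0)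
    (hP : ∀ b ≠ 0, r * θ b ^ 2 + s * θ b + t = 0) {z w : F} (hz : z ≠ 0) (hw : w ≠ 0)
    (hzw : z ∈ D ↔ w ∈ D) : sumRep D z = sumRep D w := by
  have key : ∀ z : F, z ≠ 0 → ((r * θ 0 ^ 2 + s * θ 0 + t : ℤ) : R) =
      r * (Fintype.card F * sumRep D z) + s * (if z ∈ D then (Fintype.card F : R) else 0) := by
    intro z hz
    have h0 : ∑ b, ψ (-(b * z)) = 0 := by
      have := AddChar.sum_mulShift (-z) (AddChar.IsPrimitive.of_ne_one hψ)
      simp only [mul_neg] at this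
      rw [this, if_neg (neg_ne_zero.2 hz), Nat.cast_zero]
    rw [← sum_charSum_mul hψ, ← sum_charSum_sq_mul hψ]
    have h1 : ∑ b, ((r * θ b ^ 2 + s * θ b + t : ℤ) : R) * ψ (-(b * z)) =
        ((r * θ 0 ^ 2 + s * θ 0 + t : ℤ) : R) := by
      rw [sum_eq_single_of_mem 0 (mem_univ _)]
      · simp
      · intro b _ hb
        rw [hP b hb, Int.cast_zero, zero_mul]
    rw [← h1]
    simp only [hθ]
    push_cast
    simp only [add_mul, sum_add_distrib, mul_sum, mul_assoc]
    rw [← mul_sum, ← mul_sum, ← mul_sum, h0]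
    ring
  have h := (key z hz).symm.trans (key w hw)
  simp only [hzw] at h
  have h' : r * (Fintype.card F * (sumRep D z : ℤ)) = r * (Fintype.card F * sumRep D w) := by
    apply hinj
    push_cast
    exact add_right_cancel h
  have hq : (Fintype.card F : ℤ) ≠ 0 := by exact_mod_cast Fintype.card_ne_zero
  exact_mod_cast mul_left_cancel₀ hq (mul_left_cancel₀ hr h')

end TwoValues

section Cyclotomic

variable {F R : Type*} [Field F] [Fintype F] [CommRing R] [IsDomain R]

omit [Fintype F] in
/-- The Fourier expansion of the indicator function of a union of fibres of a character `η`. -/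
lemma sum_coeff_mul_inv_pow_apply [DecidableEq F] {η : MulChar F R} {N h : ℕ}
    (hη : ∀ x ≠ 0, η x ^ N = 1)
    {a : ℕ → F} (ha : ∀ i, a i ≠ 0) (hinj : ∀ i < h, ∀ i' < h, η (a i) = η (a i') → i = i')
    {D : Finset F} (hD : ∀ x, x ∈ D ↔ x ≠ 0 ∧ ∃ i < h, η (a i) = η x) (x : F) :
    ∑ j ∈ range N, (∑ i ∈ range h, η (a i) ^ j) * (η ^ j)⁻¹ x = if x ∈ D then (N : R) else 0 := by
  classical
  rcases eq_or_ne x 0 with rfl | hx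
  · simp [hD, MulChar.map_zero]
  have hx1 : η x * η x⁻¹ = 1 := by rw [← map_mul, mul_inv_cancel₀ hx, map_one]
  have h1 : ∀ j, (η ^ j)⁻¹ x = η x⁻¹ ^ j := fun j ↦ by
    rw [MulChar.inv_apply']
    exact MulChar.pow_apply_coe η j (Units.mk0 x⁻¹ (inv_ne_zero hx))
  simp only [h1, sum_mul, ← mul_pow]
  rw [sum_comm]
  have h2 : ∀ i ∈ range h, ∑ j ∈ range N, (η (a i) * η x⁻¹) ^ j =
      if η (a i) = η x then (N : R) else 0 := by
    intro i _
    split_ifs with hi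
    · simp [hi, hx1]
    · have h3 := mul_geom_sum (η (a i) * η x⁻¹) N
      rw [mul_pow, hη _ (ha i), hη _ (inv_ne_zero hx), one_mul, sub_self] at h3
      refine (mul_eq_zero.1 h3).resolve_left fun h4 ↦ hi ?_
      linear_combination η x * h4 - η (a i) * hx1
  rw [sum_congr rfl h2]
  split_ifs with hxD
  · obtain ⟨-, i, hi, hix⟩ := (hD x).1 hxD
    rw [sum_eq_single_of_mem i (mem_range.2 hi), if_pos hix]
    intro i' hi' hne
    exact if_neg fun h ↦ hne (hinj _ (mem_range.1 hi') _ hi (h.trans hix.symm))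
  · refine sum_eq_zero fun i hi ↦ if_neg fun h ↦ hxD ((hD x).2 ⟨hx, i, mem_range.1 hi, h⟩)

lemma card_mul_charSum [DecidableEq F] {η : MulChar F R} {ψ : AddChar F R} (hψ : ψ ≠ 1) {N h : ℕ}
    (hN : 0 < N) {c : ℕ → R} (hc0 : c 0 = h) {D : Finset F}
    (hc : ∀ x, ∑ j ∈ range N, c j * (η ^ j)⁻¹ x = if x ∈ D then (N : R) else 0) {b : F}
    (hb : b ≠ 0) {r : R}
    (hdvd : ∀ j ∈ range N, j ≠ 0 → r ∣ c j * gaussSum (η ^ j)⁻¹ ψ) :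
    r ∣ N * ∑ x ∈ D, ψ (b * x) + h := by
  have h1 : (N : R) * ∑ x ∈ D, ψ (b * x) =
      ∑ j ∈ range N, c j * gaussSum (η ^ j)⁻¹ (ψ.mulShift b) := by
    have h2 : (N : R) * ∑ x ∈ D, ψ (b * x) = ∑ x, (if x ∈ D then (N : R) else 0) * ψ (b * x) := by
      simp only [ite_mul, zero_mul, sum_ite_mem, univ_inter, mul_sum]
    rw [h2]
    simp only [← hc, sum_mul, gaussSum, mul_sum, AddChar.mulShift_apply, mul_assoc]
    exact sum_comm
  have hb1 : ψ.mulShift b ≠ 1 := AddChar.IsPrimitive.of_ne_one hψ hb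
  rw [h1, ← add_sum_erase _ _ (mem_range.2 hN), hc0, pow_zero, inv_one, gaussSum_one_left hb1,
    mul_neg_one, neg_add_cancel_comm]
  refine dvd_sum fun j hj ↦ ?_
  rw [mem_erase] at hj
  obtain ⟨w, hw⟩ := hdvd j hj.2 hj.1
  have h3 : gaussSum (η ^ j)⁻¹ ψ * (η ^ j) b = gaussSum (η ^ j)⁻¹ (ψ.mulShift b) := by
    have h4 := gaussSum_mulShift (η ^ j)⁻¹ ψ (Units.mk0 b hb)
    rw [Units.val_mk0, MulChar.inv_apply'] at h4
    have h5 : (η ^ j) b⁻¹ * (η ^ j) b = 1 := by rw [← map_mul, inv_mul_cancel₀ hb, map_one]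
    linear_combination -(η ^ j) b * h4 + gaussSum (η ^ j)⁻¹ (ψ.mulShift b) * h5
  exact ⟨w * (η ^ j) b, by rw [← h3, ← mul_assoc, hw, mul_assoc]⟩

lemma card_mul_card_eq [DecidableEq F] {η : MulChar F R} {N h : ℕ}
    (hN : 0 < N) {c : ℕ → R} (hc0 : c 0 = h) {D : Finset F}
    (hc : ∀ x, ∑ j ∈ range N, c j * (η ^ j)⁻¹ x = if x ∈ D then (N : R) else 0)
    (hη : ∀ j ∈ range N, j ≠ 0 → η ^ j ≠ 1) :
    (N : R) * #D = h * (Fintype.card F - 1) := by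
  have h2 : (N : R) * #D = ∑ x, (if x ∈ D then (N : R) else 0) := by simp [mul_comm]
  rw [h2]
  simp only [← hc]
  rw [sum_comm, ← add_sum_erase _ _ (mem_range.2 hN), sum_eq_zero (s := (range N).erase 0)]
  · rw [← mul_sum, hc0, pow_zero, inv_one, MulChar.sum_one_eq_card_units,
      Fintype.card_units, Nat.cast_sub Fintype.card_pos, Nat.cast_one, add_zero]
  · intro j hj
    rw [mem_erase] at hj
    rw [← mul_sum, MulChar.sum_eq_zero_of_ne_one (inv_ne_one.2 (hη j hj.2 hj.1)), mul_zero]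

end Cyclotomic

section Main

lemma sum_pow_mul_eq_zero {R : Type*} [CommRing R] [IsDomain R] {ξ : R} {n : ℕ}
    (hξ : orderOf ξ = 7 ^ (n + 1) * 5) (k : ℕ) {j : ℕ} (h7 : 7 ∣ j) (hj : ¬7 ^ (n + 1) ∣ j) :
    ∑ i ∈ range (7 ^ n), (ξ ^ (5 * i + k * 7 ^ n)) ^ j = 0 := by
  have h1 : ∀ i, (ξ ^ (5 * i + k * 7 ^ n)) ^ j = ξ ^ (k * 7 ^ n * j) * (ξ ^ (5 * j)) ^ i :=
    fun i ↦ by rw [← pow_mul, ← pow_mul, ← pow_add]; congr 1; ring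
  simp only [h1, ← mul_sum]
  have h2 : (ξ ^ (5 * j)) ^ 7 ^ n = 1 := by
    rw [← pow_mul, ← orderOf_dvd_iff_pow_eq_one, hξ]
    obtain ⟨j, rfl⟩ := h7
    exact ⟨j, by ring⟩
  have h3 : ξ ^ (5 * j) - 1 ≠ 0 := by
    rw [sub_ne_zero, ne_eq, ← orderOf_dvd_iff_pow_eq_one, hξ, mul_comm]
    exact fun h ↦ hj (Nat.dvd_of_mul_dvd_mul_left (by norm_num) h)
  have h4 := mul_geom_sum (ξ ^ (5 * j)) (7 ^ n)
  rw [h2, sub_self] at h4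
  exact mul_eq_zero_of_right _ ((mul_eq_zero.1 h4).resolve_left h3)

variable {F : Type} [Field F] [Fintype F]

lemma exists_pow_eq {γ : Fˣ} (hγ : orderOf γ = Fintype.card F - 1) {x : F} (hx : x ≠ 0) :
    ∃ e : ℕ, x = (γ : F) ^ e := by
  classical
  have h1 : Subgroup.zpowers γ = ⊤ := by
    apply Subgroup.eq_top_of_card_eq
    rw [Nat.card_zpowers, hγ, Nat.card_eq_fintype_card, Fintype.card_units]
  have h2 : Units.mk0 x hx ∈ Subgroup.zpowers γ := h1 ▸ Subgroup.mem_top _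
  obtain ⟨e, he⟩ := mem_powers_iff_mem_zpowers.2 h2
  exact ⟨e, by simpa using (congr_arg Units.val he).symm⟩

omit [Fintype F] in
lemma orderOf_mulChar_pow {R : Type*} [CommRing R] {τ : MulChar F R} (hτ : ∀ x, τ x = 1 → x = 1)
    {γ : Fˣ} {N M : ℕ} (hγ : orderOf γ = N * M) (hM : M ≠ 0) : orderOf ((τ ^ M) γ) = N := by
  have h1 : orderOf (τ γ) = N * M := by
    rw [← hγ]
    refine orderOf_eq_orderOf_iff.2 fun e ↦ ?_
    rw [← map_pow]
    constructor
    · intro h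
      exact Units.ext (by simpa using hτ _ h)
    · intro h
      rw [← Units.val_pow_eq_pow_val, h, Units.val_one, map_one]
  rw [MulChar.pow_apply_coe, orderOf_pow_of_dvd hM (h1 ▸ Dvd.intro_left N rfl), h1,
    Nat.mul_div_cancel _ (Nat.pos_of_ne_zero hM)]

lemma neg_mem_of_isUnion {γ : Fˣ} (hγ : orderOf γ = Fintype.card F - 1) {N : ℕ} (hN : Odd N)
    (hdvd : N ∣ Fintype.card F - 1) {D : Finset F} {P : ℕ → Prop}
    (hD : ∀ x, x ∈ D ↔ ∃ s, P s ∧ ∃ t, x = (γ : F) ^ (s + N * t)) {x : F} (hx : x ∈ D) :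
    -x ∈ D := by
  obtain ⟨s, hs, t, rfl⟩ := (hD x).1 hx
  obtain ⟨e, he⟩ := exists_pow_eq hγ (neg_ne_zero.2 (one_ne_zero (α := F)))
  have h1 : γ ^ (e * 2) = 1 := Units.ext (by
    rw [Units.val_pow_eq_pow_val, pow_mul, ← he, neg_one_sq, Units.val_one])
  rw [← orderOf_dvd_iff_pow_eq_one, hγ] at h1
  obtain ⟨u, rfl⟩ := (Nat.Coprime.dvd_mul_right (Nat.coprime_two_right.2 hN)).1 (hdvd.trans h1)
  refine (hD _).2 ⟨s, hs, t + u, ?_⟩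
  rw [mul_add, ← add_assoc, pow_add _ (s + N * t), ← he, mul_neg_one]

/-- The part of Stickelberger's theorem on Gauss sums that is needed here. -/
lemma pow_dvd_sum_mul_gaussSum [CharP F 3] {R : Type*} [CommRing R] [IsDomain R] (h3 : (3 : R) ≠ 0)
    {n : ℕ} (hq : Fintype.card F = 3 ^ (12 * 7 ^ n)) {γ : Fˣ} {M : ℕ}
    (hM : 7 ^ (n + 1) * 5 * M = 3 ^ (12 * 7 ^ n) - 1) {τ : MulChar F R}
    (hξ : orderOf ((τ ^ M) γ) = 7 ^ (n + 1) * 5) {ζ : R} (hζ : 1 + ζ + ζ ^ 2 = 0)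
    {ψ : AddChar F R} (hψ : ψ ≠ 1) (hψ3 : ∀ x, ψ (x ^ 3) = ψ x) (hg : gaussSum τ ψ ∣ 1 - ζ)
    (k : ℕ) {e : ℕ} (he : e + 1 = 6 * 7 ^ n) {j : ℕ} (hj : j ∈ range (7 ^ (n + 1) * 5))
    (hj0 : j ≠ 0) :
    3 ^ e ∣ (∑ i ∈ range (7 ^ n), (τ ^ M) ((γ : F) ^ (5 * i + k * 7 ^ n)) ^ j) *
      gaussSum ((τ ^ M) ^ j)⁻¹ ψ := by
  by_cases h7 : 7 ∣ j ∧ ¬7 ^ (n + 1) ∣ j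
  · simp only [map_pow]
    rw [sum_pow_mul_eq_zero hξ k h7.1 h7.2, zero_mul]
    exact dvd_zero _
  rw [mem_range] at hj
  have hϖ : (1 - ζ) ^ 2 * -ζ ^ 2 = 3 := by linear_combination (-ζ ^ 2 + 3 * ζ - 3) * hζ
  have hϖ0 : 1 - ζ ≠ 0 := fun h ↦ h3 (by rw [← hϖ, h]; ring)
  have h1 : (3 : R) ^ e ∣ (1 - ζ) ^ (2 * e) := by
    rw [pow_mul]
    exact pow_dvd_pow_of_dvd ⟨-ζ, by linear_combination hζ⟩ e
  refine (h1.trans ?_).mul_left _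
  have hχ : (τ ^ M) ^ j ≠ 1 := by
    intro h
    have h2 : ((τ ^ M) γ) ^ j = 1 := by
      rw [← MulChar.pow_apply_coe, h, MulChar.one_apply_coe]
    rw [← orderOf_dvd_iff_pow_eq_one, hξ] at h2
    exact hj0 (Nat.eq_zero_of_dvd_of_lt h2 hj)
  refine pow_dvd_gaussSum hψ (inv_ne_one.2 hχ) (u := (-ζ ^ 2) ^ (12 * 7 ^ n)) hϖ0
    (a := 12 * 7 ^ n + 2) ?_ ?_
  · rw [hq, show 12 * 7 ^ n + 2 + 2 * e = 2 * (12 * 7 ^ n) by lia,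
      pow_mul (1 - ζ), ← mul_pow, hϖ, Nat.cast_pow, Nat.cast_ofNat]
  · have hd : M * j = ∑ i ∈ range (12 * 7 ^ n), 3 * (j * 3 ^ i % (7 ^ (n + 1) * 5)) /
        (7 ^ (n + 1) * 5) * 3 ^ (12 * 7 ^ n - 1 - i) := by
      apply Nat.eq_of_mul_eq_mul_left (show 0 < 7 ^ (n + 1) * 5 by positivity)
      rw [← sum_digits_mul_pow _ j _ hj (three_pow_mod n), ← hM]
      ring
    rw [inv_inv, ← pow_mul, hd]
    refine (gaussSum_pow_sum_dvd 3 hψ hψ3 τ _ _ _).trans ((pow_dvd_pow_of_dvd hg _).trans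
      (pow_dvd_pow _ (sum_digits_le n j hj ?_)))
    tauto

/-- The cyclotomic set has `(q - 1) / 35` elements, and the number of representations of `z ≠ 0` as
a sum of two of its elements depends only on whether `z` belongs to it. -/
lemma sumRep_eq_of_isUnion [DecidableEq F] {n : ℕ} (hq : Fintype.card F = 3 ^ (12 * 7 ^ n))
    {γ : Fˣ} (hγ : orderOf γ = Fintype.card F - 1) {k : ℕ} {D : Finset F}
    (hD : ∀ x, x ∈ D ↔ ∃ i < 7 ^ n, ∃ t, x = (γ : F) ^ (5 * i + k * 7 ^ n + 7 ^ (n + 1) * 5 * t))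
    (hneg : ∀ x ∈ D, -x ∈ D) :
    35 * #D + 1 = Fintype.card F ∧
      ∀ z w, z ≠ 0 → w ≠ 0 → (z ∈ D ↔ w ∈ D) → sumRep D z = sumRep D w := by
  have : CharP F 3 := charP_of_card_eq_prime_pow hq
  obtain ⟨R, _, _, τ, ζ, tr, ψ, hτ, hζ, hψ, htr, ⟨x₀, hx₀⟩, hg, hdvd⟩ := exists_teichmuller_data F
  have hinj : Function.Injective (Int.cast : ℤ → R) := by
    refine (injective_iff_map_eq_zero (Int.castAddHom R)).2 fun z hz ↦ ?_
    refine Int.eq_zero_of_abs_lt_dvd (hdvd z.natAbs z ?_) ?_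
    · rw [show (z : R) = 0 from hz]
      exact dvd_zero _
    · rw [Int.abs_eq_natAbs]
      exact_mod_cast Nat.lt_pow_self (by norm_num)
  have h3 : (3 : R) ≠ 0 := fun h ↦ by
    have := hinj (a₁ := 3) (a₂ := 0) (by exact_mod_cast h)
    norm_num at this
  have hψ1 : ψ ≠ 1 := by
    intro h
    have h1 : ζ ^ (tr x₀).val = 1 := by rw [← hψ, h, AddChar.one_apply]
    have hlt := ZMod.val_lt (tr x₀)
    have hne : (tr x₀).val ≠ 0 := by rwa [ne_eq, ZMod.val_eq_zero]
    generalize (tr x₀).val = v at h1 hlt hne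
    apply h3
    interval_cases v
    · contradiction
    · rw [pow_one] at h1
      rw [← hζ, h1]
      ring
    · have : ζ = -2 := by linear_combination hζ - h1
      rw [this] at h1
      linear_combination h1
  have hψ3 : ∀ x, ψ (x ^ 3) = ψ x := fun x ↦ by rw [hψ, hψ, htr]
  -- the auxiliary character of order `N`
  have hNdvd : 7 ^ (n + 1) * 5 ∣ 3 ^ (12 * 7 ^ n) - 1 :=
    (Nat.modEq_iff_dvd' (Nat.one_le_pow _ _ (by norm_num))).1 (three_pow_mod n).symm
  obtain ⟨M, hM⟩ := hNdvd
  have hq3 : 3 ≤ 3 ^ (12 * 7 ^ n) := Nat.le_self_pow (by positivity) 3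
  have hM0 : M ≠ 0 := by
    rintro rfl
    lia
  have hξ : orderOf ((τ ^ M) γ) = 7 ^ (n + 1) * 5 :=
    orderOf_mulChar_pow hτ (by rw [hγ, hq, hM]) hM0
  have hη : ∀ x ≠ 0, (τ ^ M) x ^ (7 ^ (n + 1) * 5) = 1 := by
    intro x hx
    obtain ⟨s, rfl⟩ := exists_pow_eq hγ hx
    rw [map_pow, pow_right_comm, ← hξ, pow_orderOf_eq_one, one_pow]
  have hηγ : ∀ s s', (τ ^ M) ((γ : F) ^ s) = (τ ^ M) ((γ : F) ^ s') ↔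
      s ≡ s' [MOD 7 ^ (n + 1) * 5] := by
    intro s s'
    obtain ⟨u, hu⟩ := γ.isUnit.map (τ ^ M)
    rw [map_pow, map_pow, ← hξ, ← hu, orderOf_units, ← pow_eq_pow_iff_modEq, Units.ext_iff,
      Units.val_pow_eq_pow_val, Units.val_pow_eq_pow_val]
  have hD' : ∀ x, x ∈ D ↔ x ≠ 0 ∧
      ∃ i < 7 ^ n, (τ ^ M) ((γ : F) ^ (5 * i + k * 7 ^ n)) = (τ ^ M) x := by
    intro x
    rw [hD]
    constructor
    · rintro ⟨i, hi, t, rfl⟩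
      refine ⟨pow_ne_zero _ γ.ne_zero, i, hi, (hηγ _ _).2 ?_⟩
      simp [Nat.ModEq]
    · rintro ⟨hx, i, hi, h⟩
      obtain ⟨s, rfl⟩ := exists_pow_eq hγ hx
      rw [hηγ] at h
      set r := 5 * i + k * 7 ^ n with hr
      have h1 : r ≡ s + (3 ^ (12 * 7 ^ n) - 1) * r [MOD 7 ^ (n + 1) * 5] := by
        rw [hM, mul_assoc]
        simpa [Nat.ModEq] using h
      have h2 : r ≤ s + (3 ^ (12 * 7 ^ n) - 1) * r :=
        le_add_left (Nat.le_mul_of_pos_left _ (by lia))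
      obtain ⟨t, ht⟩ := (Nat.modEq_iff_dvd' h2).1 h1
      refine ⟨i, hi, t, ?_⟩
      rw [← hr, ← ht, Nat.add_sub_cancel' h2, pow_add, pow_mul]
      have h4 : (γ : F) ^ (3 ^ (12 * 7 ^ n) - 1) = 1 := by
        rw [← hq]
        exact FiniteField.pow_card_sub_one_eq_one _ γ.ne_zero
      rw [h4, one_pow, mul_one]
  have hinj' : ∀ i < 7 ^ n, ∀ i' < 7 ^ n, (τ ^ M) ((γ : F) ^ (5 * i + k * 7 ^ n)) =
      (τ ^ M) ((γ : F) ^ (5 * i' + k * 7 ^ n)) → i = i' := by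
    intro i hi i' hi' h
    rw [hηγ] at h
    have h1 := Nat.ModEq.add_right_cancel' _ h
    have h7 : 7 ^ (n + 1) = 7 * 7 ^ n := pow_succ' 7 n
    have := h1.eq_of_lt_of_lt (by lia) (by lia)
    lia
  have hc := sum_coeff_mul_inv_pow_apply hη
    (fun i ↦ pow_ne_zero (5 * i + k * 7 ^ n) γ.ne_zero) hinj' hD'
  have hN : 0 < 7 ^ (n + 1) * 5 := by positivity
  have hN' : ((7 ^ (n + 1) * 5 : ℕ) : R) = 35 * (7 ^ n : ℕ) := by push_cast; ring
  have hc0 : ∑ i ∈ range (7 ^ n), (τ ^ M) ((γ : F) ^ (5 * i + k * 7 ^ n)) ^ 0 = (7 ^ n : ℕ) := by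
    simp
  have hcard : 35 * (#D : ℤ) = Fintype.card F - 1 := by
    have h1 := card_mul_card_eq hN hc0 hc fun j hj hj0 h ↦ by
      have h2 : ((τ ^ M) γ) ^ j = 1 := by
        rw [← MulChar.pow_apply_coe, h, MulChar.one_apply_coe]
      rw [← orderOf_dvd_iff_pow_eq_one, hξ] at h2
      exact hj0 (Nat.eq_zero_of_dvd_of_lt h2 (mem_range.1 hj))
    rw [hN'] at h1
    have h2 : (7 ^ n : ℤ) * (35 * (#D : ℤ)) = 7 ^ n * (Fintype.card F - 1) := by
      apply hinj
      push_cast at h1 ⊢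
      linear_combination h1
    exact mul_left_cancel₀ (by positivity) h2
  refine ⟨by lia, ?_⟩
  choose θ hθ using exists_int_charSum hζ tr ψ hψ hneg
  obtain ⟨m, hm⟩ : Odd (7 ^ n) := Odd.pow (by decide)
  have he : 12 * m + 5 + 1 = 6 * 7 ^ n := by lia
  set Q : ℤ := 3 ^ (12 * m + 5) with hQ
  have hQθ : ∀ b ≠ 0, Q ∣ 35 * θ b + 1 := by
    intro b hb
    have h1 := card_mul_charSum hψ1 hN hc0 hc hb fun j hj hj0 ↦
      pow_dvd_sum_mul_gaussSum h3 hq hM.symm hξ hζ hψ1 hψ3 hg k he hj hj0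
    rw [hN', hθ] at h1
    have h2 : Q ∣ 7 ^ n * (35 * θ b + 1) := by
      apply hdvd
      convert h1 using 1
      push_cast
      ring
    refine IsCoprime.dvd_of_dvd_mul_left ?_ h2
    exact IsCoprime.pow (by rw [Int.isCoprime_iff_gcd_eq_one]; norm_num)
  have hQmod : Q % 35 = 33 := by
    have h1 : ((3 : ℤ) ^ 12) ^ m * 3 ^ 5 ≡ 1 ^ m * 33 [ZMOD 35] :=
      (Int.ModEq.pow m (by decide)).mul (by decide)
    rw [one_pow, one_mul, ← pow_mul, ← pow_add] at h1
    exact h1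
  have hqQ : (Fintype.card F : ℤ) = 9 * Q ^ 2 := by
    rw [hq, hQ, ← pow_mul, show (9 : ℤ) = 3 ^ 2 by norm_num, ← pow_add]
    push_cast
    congr 1
    lia
  have h0 : 0 ∉ D := fun h ↦ ((hD' 0).1 h).1 rfl
  have hP := charSum_two_values hψ1 hinj h0 hneg (by positivity) hQmod hqQ hcard hθ hQθ
  intro z w hz hw hzw
  refine sumRep_eq hψ1 hinj hθ (r := 1225) (s := 35 * (2 + Q)) (t := (1 - 17 * Q) * (1 + 18 * Q))
    (by norm_num) (fun b hb ↦ ?_) hz hw hzw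
  rw [← hP b hb]
  ring

end Main

section StronglyRegular

open scoped Classical in
/-- The Cayley graph of `D` is strongly regular as soon as the number of representations of
`z ≠ 0` as a sum of two elements of `D` depends only on whether `z ∈ D`. -/
lemma exists_isSRGWith_fromRel {F : Type*} [AddCommGroup F] [Fintype F] {D : Finset F}
    (hneg : ∀ x ∈ D, -x ∈ D) (h0 : 0 ∉ D)
    (h : ∀ z w, z ≠ 0 → w ≠ 0 → (z ∈ D ↔ w ∈ D) → sumRep D z = sumRep D w) :
    ∃ l u : ℕ, (SimpleGraph.fromRel fun x y : F ↦ x - y ∈ D).IsSRGWith (Fintype.card F) #D l u := by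
  have hadj : ∀ x y, (SimpleGraph.fromRel fun x y : F ↦ x - y ∈ D).Adj x y ↔ x - y ∈ D := by
    intro x y
    rw [SimpleGraph.fromRel_adj]
    constructor
    · rintro ⟨-, h | h⟩
      · exact h
      · simpa using hneg _ h
    · intro h
      exact ⟨fun hxy ↦ h0 (by rwa [hxy, sub_self] at h), Or.inl h⟩
  have hcommon : ∀ v w, Fintype.card
      ((SimpleGraph.fromRel fun x y : F ↦ x - y ∈ D).commonNeighbors v w) = sumRep D (v - w) := by
    intro v w
    rw [sumRep, ← Set.toFinset_card]
    refine card_bij' (fun x _ ↦ v - x) (fun x _ ↦ v - x) ?_ ?_ (by simp) (by simp)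
    · intro x hx
      rw [Set.mem_toFinset, SimpleGraph.mem_commonNeighbors, hadj, hadj] at hx
      rw [mem_filter]
      refine ⟨hx.1, ?_⟩
      convert hneg _ hx.2 using 1
      abel
    · intro x hx
      rw [mem_filter] at hx
      rw [Set.mem_toFinset, SimpleGraph.mem_commonNeighbors, hadj, hadj]
      refine ⟨by simpa using hx.1, ?_⟩
      convert hneg _ hx.2 using 1
      abel
  have hconst : ∀ P : Prop, ∃ l, ∀ z, z ≠ 0 → (z ∈ D ↔ P) → sumRep D z = l := by
    intro P
    by_cases hP : ∃ z, z ≠ 0 ∧ (z ∈ D ↔ P)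
    · obtain ⟨z, hz, hzP⟩ := hP
      exact ⟨sumRep D z, fun w hw hwP ↦ h w z hw hz (hwP.trans hzP.symm)⟩
    · exact ⟨0, fun z hz hzP ↦ (hP ⟨z, hz, hzP⟩).elim⟩
  obtain ⟨l, hl⟩ := hconst True
  obtain ⟨u, hu⟩ := hconst False
  refine ⟨l, u, rfl, fun v ↦ ?_, fun v w hvw ↦ ?_, fun v w hne hvw ↦ ?_⟩
  · rw [← SimpleGraph.card_neighborFinset_eq_degree]
    refine card_bij' (fun x _ ↦ v - x) (fun x _ ↦ v - x) ?_ ?_ (by simp) (by simp)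
    · intro x hx
      rwa [SimpleGraph.mem_neighborFinset, hadj] at hx
    · intro x hx
      rw [SimpleGraph.mem_neighborFinset, hadj]
      simpa using hx
  · rw [hadj] at hvw
    rw [hcommon]
    exact hl _ (fun hz ↦ h0 (hz ▸ hvw)) (iff_true_intro hvw)
  · rw [hadj] at hvw
    rw [hcommon]
    exact hu _ (sub_ne_zero.2 hne) (iff_false_intro hvw)

end StronglyRegular

end

open scoped Classical

noncomputable section

/-- Each `Cay(F_q, D_k)` is a strongly regular graph of degree `(q-1)/35`,
where `q = 3^{12*7^(m-1)}`, `N = 7^m*5`. -/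
theorem cayley_srg_example_11
    (m N q : ℕ) (hm : 1 ≤ m)
    (hN : N = 7 ^ m * 5) (hq : q = 3 ^ (12 * 7 ^ (m - 1)))
    (F : Type) [Field F] [Fintype F] (hF : Fintype.card F = q)
    (γ : Fˣ) (hγ : orderOf γ = q - 1)
    (D : ℕ → Set F)
    (hD : ∀ k, D k = {x : F | ∃ i < 7 ^ (m - 1), ∃ t : ℕ,
        x = ((γ : F)) ^ (5 * i + k * 7 ^ (m - 1) + N * t)}) :
    ∀ k ≤ 34,
      SimpleGraph.fromRel (fun x y : F => x - y ∈ D k) ≠ ⊤ ∧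
      SimpleGraph.fromRel (fun x y : F => x - y ∈ D k) ≠ ⊥ ∧
      ∃ l u : ℕ, (SimpleGraph.fromRel (fun x y : F => x - y ∈ D k)).IsSRGWith
        q ((q - 1) / 35) l u := by
  intro k _
  obtain ⟨n, rfl⟩ : ∃ n, m = n + 1 := ⟨m - 1, by lia⟩
  rw [Nat.add_sub_cancel] at hq
  simp only [Nat.add_sub_cancel] at hD
  subst hN
  obtain ⟨S, hS⟩ : ∃ S : Finset F, ∀ x, x ∈ S ↔ x ∈ D k := ⟨(D k).toFinset, by simp⟩
  have hSD : ∀ x, x ∈ S ↔ ∃ i < 7 ^ n, ∃ t,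
      x = (γ : F) ^ (5 * i + k * 7 ^ n + 7 ^ (n + 1) * 5 * t) := fun x ↦ by
    rw [hS, hD]
    rfl
  have hγ' : orderOf γ = Fintype.card F - 1 := by rw [hF, hγ]
  have hdvd : 7 ^ (n + 1) * 5 ∣ Fintype.card F - 1 := by
    rw [hF, hq]
    exact (Nat.modEq_iff_dvd' (Nat.one_le_pow _ _ (by norm_num))).1 (three_pow_mod n).symm
  have hneg : ∀ x ∈ S, -x ∈ S := by
    refine fun x ↦ neg_mem_of_isUnion hγ' (Odd.mul (Odd.pow (by decide)) (by decide)) hdvd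
      (P := fun s ↦ ∃ i < 7 ^ n, s = 5 * i + k * 7 ^ n) fun x ↦ ?_
    rw [hSD]
    constructor
    · rintro ⟨i, hi, t, rfl⟩
      exact ⟨_, ⟨i, hi, rfl⟩, t, rfl⟩
    · rintro ⟨_, ⟨i, hi, rfl⟩, t, rfl⟩
      exact ⟨i, hi, t, rfl⟩
  have h0 : 0 ∉ S := fun h ↦ by
    obtain ⟨i, -, t, h⟩ := (hSD 0).1 h
    exact pow_ne_zero _ γ.ne_zero h.symm
  obtain ⟨hcard, hrep⟩ := sumRep_eq_of_isUnion (hF.trans hq) hγ' hSD hneg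
  have hq3 : 3 ≤ q := hq ▸ Nat.le_self_pow (by positivity) 3
  simp only [← hS]
  obtain ⟨l, u, hG⟩ := exists_isSRGWith_fromRel hneg h0 hrep
  rw [hF] at hcard hG
  rw [← show S.card = (q - 1) / 35 by lia]
  have hdeg := hG.regular 0
  have htop : ∀ (G : SimpleGraph F) [DecidableRel G.Adj], G = ⊤ → G.degree 0 = q - 1 := by
    rintro G _ rfl
    rw [← hF]
    convert SimpleGraph.complete_graph_degree (0 : F)
  have hbot : ∀ (G : SimpleGraph F) [DecidableRel G.Adj], G = ⊥ → G.degree 0 = 0 := by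
    rintro G _ rfl
    convert SimpleGraph.bot_degree (0 : F)
  refine ⟨fun h ↦ ?_, fun h ↦ ?_, l, u, hG⟩
  · have := (htop _ h).symm.trans hdeg
    lia
  · have := (hbot _ h).symm.trans hdeg
    lia
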